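/- Let α ∈ (1,2). There exists C > 0, depending only on α, such that for every sequence (λ_n) of positive reals, all real sequences (a_n), (b_n), and every t ≥ 0: ∑_n λ_n^{3/2} | a_n E_α(−λ_n t^α) + b_n t E_{α,2}(−λ_n t^α) |² ≤ C ∑_n λ_n^{3/2} a_n² + C t^{2−α} ∑_n λ_n^{1/2} b_n². (This is the a priori bound ‖∇Δu(t)‖² ≤ C‖∇Δu_0‖² + C t^{2−α}‖∇u_1‖² for the solution series of the fractional Petrovsky system.) -/

import Mathlib

/-- The Mittag-Leffler function `E_{α,β}(x) = ∑_{k=0}^∞ x^k / Γ(αk + β)` for real `x`. -/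
noncomputable def mittagLeffler (α β x : ℝ) : ℝ :=
  ∑' k : ℕ, x ^ k / Real.Gamma (α * k + β)

open MeasureTheory Set

lemma ml_gamma_ge (α β : ℝ) (hα : 1 < α) (hβ : 1 ≤ β) (k : ℕ) (hk : 1 ≤ k) :
    (k.factorial : ℝ) ≤ Real.Gamma (α * k + β) := by
  have hk' : (1 : ℝ) ≤ k := by exact_mod_cast hk
  rw [← Real.Gamma_nat_eq_factorial]
  apply Real.Gamma_strictMonoOn_Ici.monotoneOn
  · simp only [mem_Ici]; linarith
  · simp only [mem_Ici]; nlinarith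
  · nlinarith

lemma ml_gamma_pos (α β : ℝ) (hα : 1 < α) (hβ : 1 ≤ β) (k : ℕ) :
    0 < Real.Gamma (α * k + β) := by
  apply Real.Gamma_pos_of_pos; positivity

lemma ml_bound (α β : ℝ) (hα : 1 < α) (hβ : 1 ≤ β) :
    ∃ M : ℝ, ∀ k : ℕ, (Real.Gamma (α * k + β))⁻¹ ≤ M / k.factorial := by
  refine ⟨max 1 (Real.Gamma β)⁻¹, fun k => ?_⟩
  rcases Nat.eq_zero_or_pos k with rfl | hk
  · simp
  · have h1 := ml_gamma_ge α β hα hβ k hk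
    have h2 : (0 : ℝ) < k.factorial := by exact_mod_cast k.factorial_pos
    calc (Real.Gamma (α * k + β))⁻¹ ≤ (k.factorial : ℝ)⁻¹ := inv_anti₀ h2 h1
      _ = 1 / k.factorial := by rw [one_div]
      _ ≤ _ := by gcongr; exact le_max_left _ _

lemma ml_summable (α β : ℝ) (hα : 1 < α) (hβ : 1 ≤ β) (x : ℝ) :
    Summable fun k : ℕ => x ^ k / Real.Gamma (α * k + β) := by
  obtain ⟨M, hM⟩ := ml_bound α β hα hβ
  refine Summable.of_norm_bounded ((Real.summable_pow_div_factorial |x|).mul_left M) fun k => ?_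
  rw [Real.norm_eq_abs, abs_div, abs_pow, abs_of_pos (ml_gamma_pos α β hα hβ k), div_eq_mul_inv]
  calc |x| ^ k * (Real.Gamma (α * k + β))⁻¹ ≤ |x| ^ k * (M / k.factorial) := by
        gcongr; exact hM k
    _ = _ := by ring

lemma ml_continuous (α β : ℝ) (hα : 1 < α) (hβ : 1 ≤ β) :
    Continuous (mittagLeffler α β) := by
  rw [continuous_iff_continuousAt]
  intro x
  have : ContinuousOn (mittagLeffler α β) (Icc (-(|x| + 1)) (|x| + 1)) := by
    unfold mittagLeffler
    refine continuousOn_tsum (fun k => by fun_prop) (ml_summable α β hα hβ (|x| + 1)) ?_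
    intro k y hy
    rw [Real.norm_eq_abs, abs_div, abs_pow, abs_of_pos (ml_gamma_pos α β hα hβ k)]
    have := ml_gamma_pos α β hα hβ k
    have h2 : |y| ≤ |x| + 1 := abs_le.2 hy
    gcongr
  refine this.continuousAt (Icc_mem_nhds ?_ ?_)
  · linarith [neg_abs_le x]
  · linarith [le_abs_self x]

lemma beta_real (p q t : ℝ) (hp : 0 < p) (hq : 0 < q) (ht : 0 < t) :
    ∫ s in Ioc 0 t, s ^ (p - 1) * (t - s) ^ (q - 1) =
      t ^ (p + q - 1) * (Real.Gamma p * Real.Gamma q / Real.Gamma (p + q)) := by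
  have h := Complex.betaIntegral_scaled (p : ℂ) (q : ℂ) ht
  rw [Complex.betaIntegral_eq_Gamma_mul_div _ _ (by simpa) (by simpa)] at h
  have h2 : ∫ (x : ℝ) in 0..t, (x : ℂ) ^ ((p : ℂ) - 1) * ((t : ℂ) - (x : ℂ)) ^ ((q : ℂ) - 1)
      = ∫ (x : ℝ) in 0..t, ((x ^ (p - 1) * (t - x) ^ (q - 1) : ℝ) : ℂ) := by
    apply intervalIntegral.integral_congr
    intro x hx
    rw [uIcc_of_le ht.le] at hx
    simp only
    rw [Complex.ofReal_mul, Complex.ofReal_cpow hx.1, Complex.ofReal_cpow (sub_nonneg.2 hx.2)]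
    push_cast; rfl
  rw [h2, intervalIntegral.integral_ofReal, ← Complex.ofReal_add, Complex.Gamma_ofReal,
    Complex.Gamma_ofReal, Complex.Gamma_ofReal, ← Complex.ofReal_one, ← Complex.ofReal_sub,
    ← Complex.ofReal_cpow ht.le] at h
  rw [← intervalIntegral.integral_of_le ht.le]
  exact_mod_cast h

lemma beta_integrable (p q t : ℝ) (hp : 0 < p) (hq : 0 < q) (ht : 0 < t) :
    IntegrableOn (fun s : ℝ => s ^ (p - 1) * (t - s) ^ (q - 1)) (Ioc 0 t) := by
  apply Integrable.of_integral_ne_zero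
  rw [beta_real p q t hp hq ht]
  have := Real.Gamma_pos_of_pos hp
  have := Real.Gamma_pos_of_pos hq
  have := Real.Gamma_pos_of_pos (add_pos hp hq)
  positivity

lemma ml_conv (α β δ : ℝ) (hα : 1 < α) (hβ : 1 ≤ β) (hδ : 0 < δ) (t : ℝ) (ht : 0 < t) :
    ∫ s in Ioc 0 t, (t - s) ^ (δ - 1) * (s ^ (β - 1) * mittagLeffler α β (-(s ^ α))) =
      Real.Gamma δ * (t ^ (β + δ - 1) * mittagLeffler α (β + δ) (-(t ^ α))) := by
  set F : ℕ → ℝ → ℝ := fun k s =>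
    ((-1) ^ k / Real.Gamma (α * k + β)) * (s ^ (α * k + β - 1) * (t - s) ^ (δ - 1)) with hF
  have hpos : ∀ k : ℕ, 0 < α * k + β := fun k => by positivity
  have hFi : ∀ k, Integrable (F k) (volume.restrict (Ioc 0 t)) := fun k =>
    (beta_integrable (α * k + β) δ t (hpos k) hδ ht).const_mul _
  have hpow : ∀ k : ℕ, ∀ s : ℝ, 0 < s → ∀ c : ℝ, s ^ (α * k + c) = s ^ c * (s ^ α) ^ k := by
    intro k s hs c
    rw [Real.rpow_add hs, Real.rpow_mul hs.le, Real.rpow_natCast]; ring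
  have hval : ∀ k, ∫ s in Ioc 0 t, F k s =
      Real.Gamma δ * t ^ (β + δ - 1) * ((-(t ^ α)) ^ k / Real.Gamma (α * k + (β + δ))) := by
    intro k
    simp only [hF]
    rw [integral_const_mul, beta_real _ δ t (hpos k) hδ ht]
    have e : α * k + β + δ - 1 = α * k + (β + δ - 1) := by ring
    have := (ml_gamma_pos α β hα hβ k).ne'
    rw [e, hpow k t ht, neg_pow (t ^ α), add_assoc]
    field_simp
  have hnorm : ∀ k, ∫ s in Ioc 0 t, ‖F k s‖ =
      Real.Gamma δ * t ^ (β + δ - 1) * ((t ^ α) ^ k / Real.Gamma (α * k + (β + δ))) := by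
    intro k
    have e1 : ∫ s in Ioc 0 t, ‖F k s‖ = ∫ s in Ioc 0 t, (1 / Real.Gamma (α * k + β)) *
        (s ^ (α * k + β - 1) * (t - s) ^ (δ - 1)) := by
      apply setIntegral_congr_fun measurableSet_Ioc
      intro s hs
      simp only [hF, Real.norm_eq_abs]
      rw [abs_mul, abs_div, abs_pow, abs_neg, abs_one, one_pow,
        abs_of_pos (ml_gamma_pos α β hα hβ k), abs_of_nonneg]
      exact mul_nonneg (Real.rpow_nonneg hs.1.le _) (Real.rpow_nonneg (sub_nonneg.2 hs.2) _)
    rw [e1, integral_const_mul, beta_real _ δ t (hpos k) hδ ht]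
    have e : α * k + β + δ - 1 = α * k + (β + δ - 1) := by ring
    have := (ml_gamma_pos α β hα hβ k).ne'
    rw [e, hpow k t ht, add_assoc]
    field_simp
  have hsum := hasSum_integral_of_summable_integral_norm hFi (by
    simp_rw [hnorm]
    exact (ml_summable α (β + δ) hα (by linarith) _).mul_left _)
  have h3 := hsum.tsum_eq
  simp_rw [hval] at h3
  rw [tsum_mul_left] at h3
  rw [← mul_assoc]
  refine Eq.trans ?_ h3.symm
  apply setIntegral_congr_fun measurableSet_Ioc
  intro s hs
  simp only [hF, mittagLeffler]
  rw [← mul_assoc, ← tsum_mul_left]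
  congr 1
  ext k
  have e : α * k + β - 1 = α * k + (β - 1) := by ring
  rw [e, hpow k s hs.1, neg_pow (s ^ α)]
  ring

/-- exponential memory variable -/
noncomputable def memW (U : ℝ → ℝ) (r t : ℝ) : ℝ :=
  Real.exp (-(r * t)) * ∫ s in 0..t, Real.exp (r * s) * U s

lemma memW_deriv (U : ℝ → ℝ) (hU : Continuous U) (r t : ℝ) :
    HasDerivAt (memW U r) (U t - r * memW U r t) t := by
  have h1 : HasDerivAt (fun t => ∫ s in 0..t, Real.exp (r * s) * U s) (Real.exp (r * t) * U t) t := by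
    have hc : Continuous fun s => Real.exp (r * s) * U s := by fun_prop
    exact hc.integral_hasStrictDerivAt 0 t |>.hasDerivAt
  have h2 : HasDerivAt (fun t => Real.exp (-(r * t))) (Real.exp (-(r * t)) * (-(r * 1))) t :=
    (((hasDerivAt_id t).const_mul r).neg).exp
  have h3 := h2.mul h1
  refine h3.congr_deriv ?_
  have : Real.exp (-(r * t)) * Real.exp (r * t) = 1 := by rw [← Real.exp_add]; simp
  unfold memW
  linear_combination (U t) * this

lemma memW_cont (U : ℝ → ℝ) (hU : Continuous U) :
    Continuous (fun p : ℝ × ℝ => memW U p.1 p.2) := by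
  unfold memW
  apply Continuous.mul (by fun_prop)
  apply intervalIntegral.continuous_parametric_intervalIntegral_of_continuous
    (f := fun (p : ℝ × ℝ) s => Real.exp (p.1 * s) * U s)
  · unfold Function.uncurry; fun_prop
  · fun_prop

lemma memW_cont' (U : ℝ → ℝ) (hU : Continuous U) (r : ℝ) : Continuous (memW U r) :=
  (memW_cont U hU).comp (by fun_prop : Continuous fun t : ℝ => (r, t))

lemma memW_eq (U : ℝ → ℝ) (r t : ℝ) (ht : 0 ≤ t) :
    memW U r t = ∫ s in Ioc 0 t, Real.exp (-((t - s) * r)) * U s := by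
  unfold memW
  rw [intervalIntegral.integral_of_le ht, ← integral_const_mul]
  congr 1
  ext s
  rw [← mul_assoc, ← Real.exp_add]
  congr 2
  ring

/-- energy identity for one memory variable -/
lemma memW_energy (U : ℝ → ℝ) (hU : Continuous U) (r T : ℝ) :
    ∫ t in 0..T, memW U r t * U t =
      (memW U r T) ^ 2 / 2 + r * ∫ t in 0..T, (memW U r t) ^ 2 := by
  have hc := memW_cont' U hU r
  have h1 : ∀ t ∈ uIcc 0 T, HasDerivAt (fun t => (memW U r t) ^ 2 / 2)
      (memW U r t * (U t - r * memW U r t)) t := by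
    intro t _
    refine (((memW_deriv U hU r t).pow 2).div_const 2).congr_deriv ?_
    simp; ring
  have h2 := intervalIntegral.integral_eq_sub_of_hasDerivAt h1
    (Continuous.intervalIntegrable (by fun_prop) _ _)
  have h0 : memW U r 0 = 0 := by simp [memW]
  have e : ∫ t in 0..T, memW U r t * (U t - r * memW U r t) =
      (∫ t in 0..T, memW U r t * U t) - r * ∫ t in 0..T, (memW U r t) ^ 2 := by
    rw [← intervalIntegral.integral_const_mul, ← intervalIntegral.integral_sub
      (Continuous.intervalIntegrable (by fun_prop) _ _)
      (Continuous.intervalIntegrable (by fun_prop) _ _)]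
    congr 1; ext t; ring
  rw [e, h0] at h2
  linarith [h2]

lemma memW_int (U : ℝ → ℝ) (hU : Continuous U) (r T : ℝ) :
    ∫ t in 0..T, U t = memW U r T + r * ∫ t in 0..T, memW U r t := by
  have hc := memW_cont' U hU r
  have h2 := intervalIntegral.integral_eq_sub_of_hasDerivAt
    (fun t (_ : t ∈ uIcc 0 T) => memW_deriv U hU r t)
    (Continuous.intervalIntegrable (by fun_prop) _ _)
  have h0 : memW U r 0 = 0 := by simp [memW]
  rw [intervalIntegral.integral_sub
      (Continuous.intervalIntegrable (by fun_prop) _ _)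
      (Continuous.intervalIntegrable (by fun_prop) _ _), intervalIntegral.integral_const_mul, h0] at h2
  linarith

lemma cs_int (f : ℝ → ℝ) (hf : Continuous f) (T : ℝ) (hT : 0 < T) :
    (∫ t in 0..T, f t) ^ 2 ≤ T * ∫ t in 0..T, (f t) ^ 2 := by
  set A := ∫ t in 0..T, f t with hA
  set B := ∫ t in 0..T, (f t) ^ 2 with hB
  have h : 0 ≤ ∫ t in 0..T, (f t * T - A) ^ 2 :=
    intervalIntegral.integral_nonneg hT.le fun _ _ => sq_nonneg _
  have e : ∫ t in 0..T, (f t * T - A) ^ 2 = T ^ 2 * B - 2 * T * A * A + T * A ^ 2 := by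
    have e1 : ∀ t, (f t * T - A) ^ 2 = T ^ 2 * (f t) ^ 2 - 2 * T * A * f t + A ^ 2 := by
      intro t; ring
    simp_rw [e1]
    rw [intervalIntegral.integral_add, intervalIntegral.integral_sub,
      intervalIntegral.integral_const_mul, intervalIntegral.integral_const_mul,
      intervalIntegral.integral_const]
    · simp [hA, hB]
    all_goals exact Continuous.intervalIntegrable (by fun_prop) _ _
  rw [e] at h
  have : 0 ≤ T * (T * B - A ^ 2) := by linarith
  have := nonneg_of_mul_nonneg_right this hT
  linarith

lemma memW_key (U : ℝ → ℝ) (hU : Continuous U) (r T : ℝ) (hr : 0 < r) (hT : 0 < T)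
    (hrT : r * T ≤ 1) :
    (∫ t in 0..T, U t) ^ 2 ≤ 4 * ∫ t in 0..T, memW U r t * U t := by
  rw [memW_energy U hU, memW_int U hU r T]
  have h := cs_int (memW U r) (memW_cont' U hU r) T hT
  have hB : 0 ≤ ∫ t in 0..T, (memW U r t) ^ 2 :=
    intervalIntegral.integral_nonneg hT.le fun _ _ => sq_nonneg _
  set A := ∫ t in 0..T, memW U r t
  set B := ∫ t in 0..T, (memW U r t) ^ 2
  have h2 : r ^ 2 * A ^ 2 ≤ r * B := by
    calc r ^ 2 * A ^ 2 ≤ r ^ 2 * (T * B) := by gcongr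
      _ = (r * T) * (r * B) := by ring
      _ ≤ 1 * (r * B) := by gcongr
      _ = _ := one_mul _
  nlinarith [sq_nonneg (memW U r T - r * A), mul_nonneg hr.le hB]

lemma memW_nonneg (U : ℝ → ℝ) (hU : Continuous U) (r T : ℝ) (hr : 0 < r) (hT : 0 < T) :
    0 ≤ ∫ t in 0..T, memW U r t * U t := by
  rw [memW_energy U hU]
  have hB : 0 ≤ ∫ t in 0..T, (memW U r t) ^ 2 :=
    intervalIntegral.integral_nonneg hT.le fun _ _ => sq_nonneg _
  positivity

/-- first Fubini: superposition of memory variables gives the fractional integral -/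
lemma memW_super (α : ℝ) (h1 : 1 < α) (h2 : α < 2) (U : ℝ → ℝ) (hU : Continuous U)
    (t : ℝ) (ht : 0 < t) :
    ∫ r in Ioi (0 : ℝ), r ^ (1 - α) * memW U r t =
      Real.Gamma (2 - α) * ∫ s in Ioc 0 t, (t - s) ^ (α - 2) * U s := by
  set F : ℝ → ℝ → ℝ := fun r s => r ^ (1 - α) * Real.exp (-((t - s) * r)) * U s with hF
  have hG : ∀ s ∈ Ioo 0 t, ∫ r in Ioi (0 : ℝ), r ^ (1 - α) * Real.exp (-((t - s) * r)) =
      Real.Gamma (2 - α) * (t - s) ^ (α - 2) := by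
    intro s hs
    have h := Real.integral_rpow_mul_exp_neg_mul_Ioi (a := 2 - α) (r := t - s) (by linarith)
      (by linarith [hs.2])
    rw [show 2 - α - 1 = 1 - α by ring] at h
    rw [h, one_div, Real.inv_rpow (by linarith [hs.2]), ← Real.rpow_neg (by linarith [hs.2])]
    rw [show -(2 - α) = α - 2 by ring]; ring
  have hGam : 0 < Real.Gamma (2 - α) := Real.Gamma_pos_of_pos (by linarith)
  have hGi : ∀ s ∈ Ioo 0 t, IntegrableOn (fun r => r ^ (1 - α) * Real.exp (-((t - s) * r)))
      (Ioi (0 : ℝ)) := by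
    intro s hs
    apply Integrable.of_integral_ne_zero
    rw [hG s hs]
    have : 0 < (t - s) ^ (α - 2) := Real.rpow_pos_of_pos (by linarith [hs.2]) _
    positivity
  have hk : IntegrableOn (fun s : ℝ => (t - s) ^ (α - 2)) (Ioc 0 t) := by
    have := beta_integrable 1 (α - 1) t one_pos (by linarith) ht
    simpa [show α - 1 - 1 = α - 2 by ring] using this
  have hkU : IntegrableOn (fun s : ℝ => (t - s) ^ (α - 2) * |U s|) (Ioc 0 t) := by
    obtain ⟨M, hM⟩ := (isCompact_Icc (a := (0 : ℝ)) (b := t)).exists_bound_of_continuousOn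
      hU.continuousOn
    refine Integrable.mul_bdd (c := M) hk (by fun_prop) ?_
    refine (ae_restrict_iff' measurableSet_Ioc).2 (Filter.Eventually.of_forall fun s hs => ?_)
    simpa using hM s ⟨hs.1.le, hs.2⟩
  have hae : ∀ᵐ s ∂(volume.restrict (Ioc 0 t)), s ∈ Ioo 0 t := by
    rw [← restrict_Ioo_eq_restrict_Ioc]
    exact ae_restrict_mem measurableSet_Ioo
  have hint : Integrable (Function.uncurry F)
      ((volume.restrict (Ioi (0 : ℝ))).prod (volume.restrict (Ioc 0 t))) := by
    rw [integrable_prod_iff']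
    · constructor
      · filter_upwards [hae] with s hs
        exact (hGi s hs).mul_const (U s)
      · refine (hkU.const_mul (Real.Gamma (2 - α))).congr ?_
        filter_upwards [hae] with s hs
        rw [← mul_assoc, ← hG s hs, ← integral_mul_const]
        apply setIntegral_congr_fun measurableSet_Ioi
        intro r hr
        simp only [Function.uncurry, hF, Real.norm_eq_abs]
        rw [abs_mul, abs_of_nonneg (mul_nonneg (Real.rpow_nonneg (le_of_lt hr) _) (Real.exp_pos _).le)]
    · apply Measurable.aestronglyMeasurable
      unfold Function.uncurry
      simp only [hF]
      have := hU.measurable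
      fun_prop
  have hsw := integral_integral_swap hint
  have e1 : ∫ r in Ioi (0 : ℝ), r ^ (1 - α) * memW U r t =
      ∫ r in Ioi (0 : ℝ), ∫ s in Ioc 0 t, F r s := by
    congr 1; ext r
    rw [memW_eq U r t ht.le, ← integral_const_mul]
    congr 1; ext s; simp only [hF]; ring
  rw [e1, hsw, ← integral_const_mul]
  apply integral_congr_ae
  filter_upwards [hae] with s hs
  simp only [hF]
  rw [integral_mul_const, hG s hs]; ring

lemma memW_abs (U : ℝ → ℝ) (T M : ℝ) (hM : ∀ s ∈ Icc 0 T, |U s| ≤ M) (hM0 : 0 ≤ M)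
    (r t : ℝ) (hr : 0 < r) (ht : t ∈ Ioc 0 T) :
    |memW U r t| ≤ M * min T (1 / r) := by
  have hi : ∫ s in 0..t, Real.exp (r * s) * M = M * ((Real.exp (r * t) - 1) / r) := by
    rw [intervalIntegral.integral_mul_const, intervalIntegral.integral_comp_mul_left _ hr.ne']
    simp; ring
  have hab : |∫ s in 0..t, Real.exp (r * s) * U s| ≤ ∫ s in 0..t, Real.exp (r * s) * M := by
    rw [← Real.norm_eq_abs]
    refine intervalIntegral.norm_integral_le_of_norm_le ht.1.le ?_
      (Continuous.intervalIntegrable (by fun_prop) _ _)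
    refine Filter.Eventually.of_forall fun s hs => ?_
    rw [norm_mul, Real.norm_eq_abs, Real.norm_eq_abs, abs_of_pos (Real.exp_pos _)]
    gcongr
    exact hM s ⟨hs.1.le, hs.2.trans ht.2⟩
  have hW : |memW U r t| ≤ M * ((1 - Real.exp (-(r * t))) / r) := by
    unfold memW
    rw [abs_mul, abs_of_pos (Real.exp_pos _)]
    calc _ ≤ Real.exp (-(r * t)) * (M * ((Real.exp (r * t) - 1) / r)) := by
          rw [← hi]; gcongr
      _ = M * ((Real.exp (-(r * t)) * Real.exp (r * t) - Real.exp (-(r * t))) / r) := by ring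
      _ = _ := by rw [← Real.exp_add]; simp
  refine hW.trans ?_
  gcongr
  apply le_min
  · rw [div_le_iff₀ hr]
    have := Real.add_one_le_exp (-(r * t))
    nlinarith [ht.2]
  · gcongr
    linarith [Real.exp_pos (-(r * t))]

lemma weight_integrable (α T : ℝ) (h1 : 1 < α) (h2 : α < 2) (hT : 0 < T) :
    IntegrableOn (fun r : ℝ => r ^ (1 - α) * min T (1 / r)) (Ioi 0) := by
  have hm : Measurable (fun r : ℝ => r ^ (1 - α) * min T (1 / r)) := by fun_prop
  rw [← Ioc_union_Ioi_eq_Ioi zero_le_one]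
  apply IntegrableOn.union
  · have h : IntegrableOn (fun r : ℝ => r ^ (1 - α) * T) (Ioc 0 1) := by
      refine Integrable.mul_const ?_ _
      exact (intervalIntegrable_iff_integrableOn_Ioc_of_le zero_le_one).1
        (intervalIntegral.intervalIntegrable_rpow' (by linarith))
    refine Integrable.mono' h hm.aestronglyMeasurable ?_
    refine (ae_restrict_iff' measurableSet_Ioc).2 (Filter.Eventually.of_forall fun r hr => ?_)
    have hr0 := hr.1
    rw [Real.norm_eq_abs, abs_of_nonneg (by positivity)]
    gcongr
    exact min_le_left _ _
  · have h := integrableOn_Ioi_rpow_of_lt (a := -α) (c := 1) (by linarith) one_pos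
    refine Integrable.mono' h hm.aestronglyMeasurable ?_
    refine (ae_restrict_iff' measurableSet_Ioi).2 (Filter.Eventually.of_forall fun r hr => ?_)
    have hr0 : 0 < r := one_pos.trans hr
    rw [Real.norm_eq_abs, abs_of_nonneg (by positivity)]
    calc r ^ (1 - α) * min T (1 / r) ≤ r ^ (1 - α) * (1 / r) := by
          gcongr; exact min_le_right _ _
      _ = r ^ (-α) := by
          rw [show (1 - α) = -α + 1 by ring, Real.rpow_add_one hr0.ne']; field_simp

/-- The energy estimate. -/
lemma energy_main (α : ℝ) (h1 : 1 < α) (h2 : α < 2) (U g : ℝ → ℝ) (hg : Continuous g)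
    (hU : ∀ t, HasDerivAt U (-g t) t) (hU0 : U 0 = 1)
    (hconv : ∀ t, 0 < t → ∫ s in Ioc 0 t, (t - s) ^ (α - 2) * U s = Real.Gamma (α - 1) * g t)
    (T : ℝ) (hT : 0 < T) :
    IntegrableOn (fun r => r ^ (1 - α) * ∫ t in 0..T, memW U r t * U t) (Ioi 0) ∧
    ∫ r in Ioi (0 : ℝ), r ^ (1 - α) * ∫ t in 0..T, memW U r t * U t =
      Real.Gamma (2 - α) * Real.Gamma (α - 1) * ((1 - U T ^ 2) / 2) := by
  have hUc : Continuous U := continuous_iff_continuousAt.2 fun t => (hU t).continuousAt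
  obtain ⟨M, hM⟩ := (isCompact_Icc (a := (0 : ℝ)) (b := T)).exists_bound_of_continuousOn
      hUc.continuousOn
  have hM0 : 0 ≤ M := (norm_nonneg _).trans (hM 0 ⟨le_rfl, hT.le⟩)
  set G : ℝ → ℝ → ℝ := fun r t => r ^ (1 - α) * (memW U r t * U t) with hG
  have hint : Integrable (Function.uncurry G)
      ((volume.restrict (Ioi (0 : ℝ))).prod (volume.restrict (Ioc 0 T))) := by
    have hdom : Integrable (fun z : ℝ × ℝ => (z.1 ^ (1 - α) * min T (1 / z.1)) * (M * M))
        ((volume.restrict (Ioi (0 : ℝ))).prod (volume.restrict (Ioc 0 T))) :=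
      Integrable.mul_prod (weight_integrable α T h1 h2 hT) (integrable_const (M * M))
    refine Integrable.mono' hdom ?_ ?_
    · apply Measurable.aestronglyMeasurable
      unfold Function.uncurry
      simp only [hG]
      have := hUc.measurable
      have := (memW_cont U hUc).measurable
      fun_prop
    · rw [Measure.prod_restrict]
      refine (ae_restrict_iff' (measurableSet_Ioi.prod measurableSet_Ioc)).2
        (Filter.Eventually.of_forall fun z hz => ?_)
      obtain ⟨hr, ht⟩ := hz
      have hr : 0 < z.1 := hr
      simp only [Function.uncurry, hG, norm_mul, Real.norm_eq_abs]
      rw [abs_of_nonneg (Real.rpow_nonneg hr.le _)]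
      have a1 := memW_abs U T M hM hM0 z.1 z.2 hr ht
      have a2 : |U z.2| ≤ M := hM z.2 ⟨ht.1.le, ht.2⟩
      have : 0 ≤ z.1 ^ (1 - α) := Real.rpow_nonneg hr.le _
      calc _ ≤ z.1 ^ (1 - α) * (M * min T (1 / z.1) * M) := by gcongr
        _ = _ := by ring
  have e1 : ∀ r, r ^ (1 - α) * ∫ t in 0..T, memW U r t * U t = ∫ t in Ioc 0 T, G r t := by
    intro r
    rw [intervalIntegral.integral_of_le hT.le, ← integral_const_mul]
  simp_rw [e1]
  refine ⟨hint.integral_prod_left, ?_⟩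
  rw [integral_integral_swap hint]
  have e2 : ∫ t in Ioc 0 T, ∫ r in Ioi (0 : ℝ), G r t =
      ∫ t in Ioc 0 T, Real.Gamma (2 - α) * Real.Gamma (α - 1) * (g t * U t) := by
    apply setIntegral_congr_fun measurableSet_Ioc
    intro t ht
    simp only [hG]
    simp_rw [← mul_assoc]
    rw [integral_mul_const, memW_super α h1 h2 U hUc t ht.1, hconv t ht.1]
    ring
  rw [e2, integral_const_mul, ← intervalIntegral.integral_of_le hT.le]
  congr 1
  have h3 : ∀ t ∈ uIcc 0 T, HasDerivAt (fun t => -((U t) ^ 2 / 2)) (g t * U t) t := by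
    intro t _
    refine ((((hU t).pow 2).div_const 2).neg).congr_deriv ?_
    simp; ring
  rw [intervalIntegral.integral_eq_sub_of_hasDerivAt h3
    (Continuous.intervalIntegrable (by fun_prop) _ _), hU0]
  ring

lemma energy_bounds (α : ℝ) (h1 : 1 < α) (h2 : α < 2) (U g : ℝ → ℝ) (hg : Continuous g)
    (hU : ∀ t, HasDerivAt U (-g t) t) (hU0 : U 0 = 1)
    (hconv : ∀ t, 0 < t → ∫ s in Ioc 0 t, (t - s) ^ (α - 2) * U s = Real.Gamma (α - 1) * g t)
    (T : ℝ) (hT : 0 < T) :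
    U T ^ 2 ≤ 1 ∧ (∫ t in 0..T, U t) ^ 2 ≤
      2 * (2 - α) * (Real.Gamma (2 - α) * Real.Gamma (α - 1)) * T ^ (2 - α) := by
  have hUc : Continuous U := continuous_iff_continuousAt.2 fun t => (hU t).continuousAt
  obtain ⟨hi, he⟩ := energy_main α h1 h2 U g hg hU hU0 hconv T hT
  have hc : 0 < Real.Gamma (2 - α) * Real.Gamma (α - 1) :=
    mul_pos (Real.Gamma_pos_of_pos (by linarith)) (Real.Gamma_pos_of_pos (by linarith))
  set c := Real.Gamma (2 - α) * Real.Gamma (α - 1)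
  set V := ∫ t in 0..T, U t
  have hpos : ∀ r ∈ Ioi (0 : ℝ), 0 ≤ r ^ (1 - α) * ∫ t in 0..T, memW U r t * U t := fun r hr =>
    mul_nonneg (Real.rpow_nonneg (le_of_lt hr) _) (memW_nonneg U hUc r T hr hT)
  constructor
  · have := setIntegral_nonneg (μ := volume) measurableSet_Ioi hpos
    rw [he] at this
    have := nonneg_of_mul_nonneg_right this hc
    linarith
  · have hTi : 0 < 1 / T := by positivity
    have i1 : IntegrableOn (fun r : ℝ => r ^ (1 - α)) (Ioc 0 (1 / T)) :=
      (intervalIntegrable_iff_integrableOn_Ioc_of_le hTi.le).1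
        (intervalIntegral.intervalIntegrable_rpow' (by linarith))
    have a1 : ∫ r in Ioc 0 (1 / T), r ^ (1 - α) * V ^ 2 ≤
        ∫ r in Ioc 0 (1 / T), 4 * (r ^ (1 - α) * ∫ t in 0..T, memW U r t * U t) := by
      refine setIntegral_mono_on (i1.mul_const _) ((hi.mono_set Ioc_subset_Ioi_self).const_mul 4)
        measurableSet_Ioc fun r hr => ?_
      have hk := memW_key U hUc r T hr.1 hT (by
        have := hr.2; rwa [le_div_iff₀ hT] at this)
      have : 0 ≤ r ^ (1 - α) := Real.rpow_nonneg hr.1.le _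
      calc _ ≤ r ^ (1 - α) * (4 * ∫ t in 0..T, memW U r t * U t) := by gcongr
        _ = _ := by ring
    have a2 : ∫ r in Ioc 0 (1 / T), (r ^ (1 - α) * ∫ t in 0..T, memW U r t * U t) ≤
        ∫ r in Ioi (0 : ℝ), (r ^ (1 - α) * ∫ t in 0..T, memW U r t * U t) :=
      setIntegral_mono_set hi ((ae_restrict_iff' measurableSet_Ioi).2
        (Filter.Eventually.of_forall hpos)) (Ioc_subset_Ioi_self.eventuallyLE)
    have a3 : ∫ r in Ioc 0 (1 / T), r ^ (1 - α) = T ^ (α - 2) / (2 - α) := by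
      rw [← intervalIntegral.integral_of_le hTi.le, integral_rpow (Or.inl (by linarith)),
        Real.zero_rpow (by linarith), one_div, Real.inv_rpow hT.le, ← Real.rpow_neg hT.le]
      rw [show -(1 - α + 1) = α - 2 by ring, show 1 - α + 1 = 2 - α by ring, sub_zero]
    rw [integral_mul_const, integral_const_mul, a3] at a1
    rw [he] at a2
    have a4 : T ^ (α - 2) / (2 - α) * V ^ 2 ≤ 2 * c := by nlinarith [sq_nonneg (U T)]
    have a5 : T ^ (α - 2) * T ^ (2 - α) = 1 := by
      rw [← Real.rpow_add hT]; simp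
    have a6 : 0 < T ^ (2 - α) := Real.rpow_pos_of_pos hT _
    have h2' : 0 < 2 - α := by linarith
    calc V ^ 2 = (T ^ (α - 2) * T ^ (2 - α)) * V ^ 2 := by rw [a5, one_mul]
      _ = (T ^ (α - 2) / (2 - α) * V ^ 2) * ((2 - α) * T ^ (2 - α)) := by field_simp
      _ ≤ 2 * c * ((2 - α) * T ^ (2 - α)) := by gcongr
      _ = _ := by ring

lemma ml_bounds (α : ℝ) (h1 : 1 < α) (h2 : α < 2) (T : ℝ) (hT : 0 < T) :
    mittagLeffler α 1 (-(T ^ α)) ^ 2 ≤ 1 ∧ (T * mittagLeffler α 2 (-(T ^ α))) ^ 2 ≤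
      2 * (2 - α) * (Real.Gamma (2 - α) * Real.Gamma (α - 1)) * T ^ (2 - α) := by
  set g : ℝ → ℝ := fun t => t ^ (α - 1) * mittagLeffler α α (-(t ^ α)) with hgdef
  have hg : Continuous g := by
    have c1 : Continuous fun t : ℝ => t ^ α := Real.continuous_rpow_const (by linarith)
    have c2 : Continuous fun t : ℝ => t ^ (α - 1) := Real.continuous_rpow_const (by linarith)
    exact c2.mul ((ml_continuous α α h1 h1.le).comp c1.neg)
  set U : ℝ → ℝ := fun t => 1 - ∫ s in 0..t, g s with hUdef
  have hU : ∀ t, HasDerivAt U (-g t) t := fun t =>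
    ((hg.integral_hasStrictDerivAt 0 t).hasDerivAt).const_sub 1
  have hU0 : U 0 = 1 := by simp [hUdef]
  have hUE : ∀ t, 0 < t → U t = mittagLeffler α 1 (-(t ^ α)) := by
    intro t ht
    have h := ml_conv α α 1 h1 h1.le one_pos t ht
    simp only [sub_self, Real.rpow_zero, one_mul, Real.Gamma_one, add_sub_cancel_right] at h
    simp only [hUdef, hgdef]
    rw [intervalIntegral.integral_of_le ht.le, h]
    have hs := (ml_summable α 1 h1 le_rfl (-(t ^ α))).tsum_eq_zero_add
    simp only [mittagLeffler]
    rw [hs, ← tsum_mul_left, sub_eq_add_neg, ← tsum_neg]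
    simp only [pow_zero, Nat.cast_zero, mul_zero, zero_add, Real.Gamma_one, div_one]
    congr 1
    congr 1; ext k
    push_cast
    rw [show α * (k + 1 : ℝ) + 1 = α * k + (α + 1) by ring]
    ring
  have hconv : ∀ t, 0 < t →
      ∫ s in Ioc 0 t, (t - s) ^ (α - 2) * U s = Real.Gamma (α - 1) * g t := by
    intro t ht
    have h := ml_conv α 1 (α - 1) h1 le_rfl (by linarith) t ht
    simp only [sub_self, Real.rpow_zero, one_mul, add_sub_cancel,
      show α - 1 - 1 = α - 2 by ring] at h
    rw [← h]
    apply setIntegral_congr_fun measurableSet_Ioc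
    intro s hs
    simp only
    rw [hUE s hs.1]
  have hV : ∫ t in 0..T, U t = T * mittagLeffler α 2 (-(T ^ α)) := by
    have h := ml_conv α 1 1 h1 le_rfl one_pos T hT
    simp only [sub_self, Real.rpow_zero, one_mul, Real.Gamma_one, 
      Real.rpow_one, one_add_one_eq_two, show (2 : ℝ) - 1 = 1 by norm_num] at h
    rw [← h, intervalIntegral.integral_of_le hT.le]
    apply setIntegral_congr_fun measurableSet_Ioc
    intro s hs
    exact hUE s hs.1
  have := energy_bounds α h1 h2 U g hg hU hU0 hconv T hT
  rwa [hV, hUE T hT] at this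

lemma ml_bounds' (α : ℝ) (h1 : 1 < α) (h2 : α < 2) (x : ℝ) (hx : 0 < x) :
    mittagLeffler α 1 (-x) ^ 2 ≤ 1 ∧ x * mittagLeffler α 2 (-x) ^ 2 ≤
      2 * (2 - α) * (Real.Gamma (2 - α) * Real.Gamma (α - 1)) := by
  set T := x ^ (1 / α) with hTd
  have hT : 0 < T := Real.rpow_pos_of_pos hx _
  have hTx : T ^ α = x := by
    rw [hTd, ← Real.rpow_mul hx.le, one_div, inv_mul_cancel₀ (by linarith), Real.rpow_one]
  have h := ml_bounds α h1 h2 T hT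
  rw [hTx] at h
  refine ⟨h.1, ?_⟩
  have e : T ^ 2 = x * T ^ (2 - α) := by
    rw [← hTx, ← Real.rpow_add hT]; simp
  have h3 := h.2
  rw [mul_pow, e] at h3
  have hp : 0 < T ^ (2 - α) := Real.rpow_pos_of_pos hT _
  refine le_of_mul_le_mul_right ?_ hp
  linarith

lemma termwise (α : ℝ) (hα₁ : 1 < α) (hα₂ : α < 2) (K : ℝ) (hK : 0 ≤ K)
    (hb : ∀ x : ℝ, 0 < x → mittagLeffler α 1 (-x) ^ 2 ≤ 1 ∧ x * mittagLeffler α 2 (-x) ^ 2 ≤ K)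
    (l a b t : ℝ) (hl : 0 < l) (ht : 0 ≤ t) :
    l ^ ((3 : ℝ) / 2) * (a * mittagLeffler α 1 (-l * t ^ α) +
            b * t * mittagLeffler α 2 (-l * t ^ α)) ^ 2 ≤
      (2 + 2 * K) * (l ^ ((3 : ℝ) / 2) * a ^ 2) +
        ((2 + 2 * K) * t ^ (2 - α)) * (l ^ ((1 : ℝ) / 2) * b ^ 2) := by
  have p3 : 0 < l ^ ((3 : ℝ) / 2) := Real.rpow_pos_of_pos hl _
  have p1 : 0 < l ^ ((1 : ℝ) / 2) := Real.rpow_pos_of_pos hl _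
  rcases ht.eq_or_lt with rfl | ht
  · have e : mittagLeffler α 1 0 = 1 := by
      unfold mittagLeffler
      rw [tsum_eq_single 0]
      · simp
      · intro k hk; simp [hk]
    rw [Real.zero_rpow (by linarith), Real.zero_rpow (by linarith)]
    simp only [mul_zero, e, zero_mul, add_zero, mul_one]
    have : 0 ≤ l ^ ((3 : ℝ) / 2) * a ^ 2 := by positivity
    nlinarith
  · have hta : 0 < t ^ α := Real.rpow_pos_of_pos ht _
    have htb : 0 < t ^ (2 - α) := Real.rpow_pos_of_pos ht _
    obtain ⟨b1, b2⟩ := hb (l * t ^ α) (by positivity)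
    rw [neg_mul]
    set E1 := mittagLeffler α 1 (-(l * t ^ α))
    set E2 := mittagLeffler α 2 (-(l * t ^ α))
    have el : l ^ ((3 : ℝ) / 2) = l ^ ((1 : ℝ) / 2) * l := by
      rw [← Real.rpow_add_one hl.ne']; norm_num
    have et : t ^ 2 = t ^ α * t ^ (2 - α) := by
      rw [← Real.rpow_add ht]; simp
    calc l ^ ((3 : ℝ) / 2) * (a * E1 + b * t * E2) ^ 2
        ≤ l ^ ((3 : ℝ) / 2) * (2 * (a ^ 2 * E1 ^ 2) + 2 * (b ^ 2 * t ^ 2 * E2 ^ 2)) := by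
          gcongr
          nlinarith [sq_nonneg (a * E1 - b * t * E2)]
      _ = 2 * (l ^ ((3 : ℝ) / 2) * a ^ 2) * E1 ^ 2 +
          2 * t ^ (2 - α) * (l ^ ((1 : ℝ) / 2) * b ^ 2) * (l * t ^ α * E2 ^ 2) := by
          rw [et, el]; ring
      _ ≤ 2 * (l ^ ((3 : ℝ) / 2) * a ^ 2) * 1 +
          2 * t ^ (2 - α) * (l ^ ((1 : ℝ) / 2) * b ^ 2) * K := by
          gcongr
      _ ≤ _ := by
          have q1 : 0 ≤ K * (l ^ ((3 : ℝ) / 2) * a ^ 2) := by positivity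
          have q2 : 0 ≤ t ^ (2 - α) * (l ^ ((1 : ℝ) / 2) * b ^ 2) := by positivity
          linarith

/-- For `α ∈ (1,2)` there is `C > 0` depending only on `α` such that for all positive
`λ_n`, all real `a_n, b_n` and all `t ≥ 0` (sums taken in `[0,∞]`):
`∑ λ_n^{3/2} |a_n E_α(-λ_n t^α) + b_n t E_{α,2}(-λ_n t^α)|²
  ≤ C ∑ λ_n^{3/2} a_n² + C t^{2-α} ∑ λ_n^{1/2} b_n²`.
This is the bound `‖∇Δu(t)‖² ≤ C‖∇Δu_0‖² + C t^{2-α}‖∇u_1‖²`. -/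
theorem petrovsky_nablaDelta_bound (α : ℝ) (hα₁ : 1 < α) (hα₂ : α < 2) :
    ∃ C > (0 : ℝ), ∀ lam a b : ℕ → ℝ, (∀ n, 0 < lam n) → ∀ t : ℝ, 0 ≤ t →
      (∑' n, ENNReal.ofReal ((lam n) ^ ((3 : ℝ) / 2) *
          (a n * mittagLeffler α 1 (-(lam n) * t ^ α) +
            b n * t * mittagLeffler α 2 (-(lam n) * t ^ α)) ^ 2)) ≤
        ENNReal.ofReal C *
            (∑' n, ENNReal.ofReal ((lam n) ^ ((3 : ℝ) / 2) * (a n) ^ 2)) +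
          ENNReal.ofReal (C * t ^ (2 - α)) *
            (∑' n, ENNReal.ofReal ((lam n) ^ ((1 : ℝ) / 2) * (b n) ^ 2)) := by
  set K := 2 * (2 - α) * (Real.Gamma (2 - α) * Real.Gamma (α - 1)) with hKd
  have hK : 0 ≤ K := by
    have g1 := Real.Gamma_pos_of_pos (show 0 < 2 - α by linarith)
    have g2 := Real.Gamma_pos_of_pos (show 0 < α - 1 by linarith)
    have : 0 < 2 - α := by linarith
    positivity
  refine ⟨2 + 2 * K, by positivity, ?_⟩
  intro lam a b hlam t ht
  have htb : 0 ≤ t ^ (2 - α) := Real.rpow_nonneg ht _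
  rw [← ENNReal.tsum_mul_left, ← ENNReal.tsum_mul_left, ← ENNReal.tsum_add]
  refine ENNReal.tsum_le_tsum fun n => ?_
  have p3 : 0 < lam n ^ ((3 : ℝ) / 2) := Real.rpow_pos_of_pos (hlam n) _
  have p1 : 0 < lam n ^ ((1 : ℝ) / 2) := Real.rpow_pos_of_pos (hlam n) _
  rw [← ENNReal.ofReal_mul (by positivity), ← ENNReal.ofReal_mul (by positivity),
    ← ENNReal.ofReal_add (by positivity) (by positivity)]
  exact ENNReal.ofReal_le_ofReal (termwise α hα₁ hα₂ K hK
    (fun x hx => ml_bounds' α hα₁ hα₂ x hx) _ _ _ _ (hlam n) ht)
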